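/- Let (R,m) be a Cohen-Macaulay local ring of Krull dimension d and let C be a semidualizing R-module. Then H_m^d(C) is a C-injective R-module if and only if H_m^d(C ⊗_R C) is an injective R-module. -/

import Mathlib

/-!
Common definitions: semidualizing modules, `C`-injective modules and dimensions,
`G_C`-injective modules, Bass/Auslander classes, relative Cohen-Macaulayness,
Cohen-Macaulay and Gorenstein local rings, trivial extensions, ideal torsion.
-/

noncomputable section

open CategoryTheory TensorProduct

universe u

variable (R : Type u) [CommRing R]

/-- An `R`-module `M` is `C`-injective if it is isomorphic to `Hom_R(C, I)`
for some injective `R`-module `I`. -/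
def IsCInjective (C M : ModuleCat.{u} R) : Prop :=
  ∃ I : ModuleCat.{u} R, Module.Injective R I ∧ Nonempty (M ≃ₗ[R] (C →ₗ[R] I))

/-- `HasCoresDimLE R P n M` : the module `M` admits a coresolution of length at most `n`
by modules satisfying the property `P`. -/
def HasCoresDimLE (P : ModuleCat.{u} R → Prop) : ℕ → ModuleCat.{u} R → Prop
  | 0, M => Subsingleton M ∨ P M
  | n + 1, M => Subsingleton M ∨ ∃ (X : ModuleCat.{u} R) (f : M →ₗ[R] X),
      P X ∧ Function.Injective f ∧
        HasCoresDimLE P n (ModuleCat.of R (X ⧸ LinearMap.range f))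

/-- The coresolution dimension of `M` with respect to the class of modules satisfying `P`,
as an element of `ℕ∞` (`⊤` meaning no finite coresolution exists). -/
def coresDim (P : ModuleCat.{u} R → Prop) (M : ModuleCat.{u} R) : ℕ∞ :=
  sInf {d : ℕ∞ | ∃ n : ℕ, d = n ∧ HasCoresDimLE R P n M}

/-- The `C`-injective dimension of `M`. -/
def cinjDim (C M : ModuleCat.{u} R) : ℕ∞ :=
  coresDim R (IsCInjective R C) M

/-- The injective dimension of `M`. -/
def injDim (M : ModuleCat.{u} R) : ℕ∞ :=
  coresDim R (fun N => Module.Injective R N) M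

/-- A finitely generated `R`-module `C` is semidualizing if the natural map
`R → Hom_R(C,C)` is bijective and `Ext_R^i(C,C) = 0` for all `i ≥ 1`. -/
def IsSemidualizing (C : ModuleCat.{u} R) : Prop :=
  Module.Finite R C ∧ Function.Bijective (LinearMap.lsmul R C) ∧
    ∀ i : ℕ, 1 ≤ i →
      Subsingleton (((Ext R (ModuleCat.{u} R) i).obj (Opposite.op C)).obj C)

/-- A dualizing module is a semidualizing module of finite injective dimension. -/
def IsDualizing (C : ModuleCat.{u} R) : Prop :=
  IsSemidualizing R C ∧ injDim R C ≠ ⊤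

/-- A complete `I_C I`-resolution: an exact complex `Y` (with `d i : Y (i+1) → Y i`)
which stays exact after applying `Hom_R(I, -)` for every `C`-injective `I`, whose terms
in positive degrees are `C`-injective and whose terms in degrees `≤ 0` are injective. -/
structure CompleteICIResolution (C : ModuleCat.{u} R) where
  Y : ℤ → ModuleCat.{u} R
  d : (i : ℤ) → (Y (i + 1) →ₗ[R] Y i)
  exact : ∀ i : ℤ, Function.Exact (d (i + 1)) (d i)
  cinj_pos : ∀ i : ℤ, 0 < i → IsCInjective R C (Y i)
  inj_nonpos : ∀ i : ℤ, i ≤ 0 → Module.Injective R (Y i)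
  homExact : ∀ I : ModuleCat.{u} R, IsCInjective R C I → ∀ i : ℤ,
    Function.Exact (fun f : I →ₗ[R] Y (i + 1 + 1) => (d (i + 1)).comp f)
      (fun f : I →ₗ[R] Y (i + 1) => (d i).comp f)

/-- A module is `G_C`-injective if it is the kernel of the degree-`0` differential of some
complete `I_C I`-resolution. -/
def IsGCInjective (C M : ModuleCat.{u} R) : Prop :=
  ∃ res : CompleteICIResolution R C,
    Nonempty (M ≃ₗ[R] ↥(LinearMap.ker (res.d (-1))))

/-- The `G_C`-injective dimension of `M`. -/
def gcinjDim (C M : ModuleCat.{u} R) : ℕ∞ :=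
  coresDim R (IsGCInjective R C) M

/-- `M` is relative Cohen-Macaulay with respect to `a`: there is exactly one
non-vanishing local cohomology module of `M` with respect to `a`. -/
def IsRelativeCM (a : Ideal R) (M : ModuleCat.{u} R) : Prop :=
  ∃! n : ℕ, Nontrivial ((localCohomology a n).obj M)

/-- `M` is relative Cohen-Macaulay with respect to `a`, with (unique) non-vanishing
local cohomology in degree `n`. -/
def IsRelativeCMAt (a : Ideal R) (n : ℕ) (M : ModuleCat.{u} R) : Prop :=
  Nontrivial ((localCohomology a n).obj M) ∧
    ∀ i : ℕ, i ≠ n → Subsingleton ((localCohomology a i).obj M)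

/-- The cohomological dimension `cd(a, M)`: the largest `i` with `H_a^i(M) ≠ 0`. -/
def lcCohomDim (a : Ideal R) (M : ModuleCat.{u} R) : ℕ :=
  sSup {i : ℕ | Nontrivial ((localCohomology a i).obj M)}

/-- The grade `grade(a, M)`: the least `i` with `H_a^i(M) ≠ 0`. -/
def lcGrade (a : Ideal R) (M : ModuleCat.{u} R) : ℕ :=
  sInf {i : ℕ | Nontrivial ((localCohomology a i).obj M)}

/-- A Noetherian local ring is Cohen-Macaulay iff `H_m^i(R) = 0` for all `i ≠ dim R`
(Grothendieck's characterization, taken here as the definition). -/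
def IsCohenMacaulayLocalRing (S : Type u) [CommRing S] [IsLocalRing S] : Prop :=
  ∀ i : ℕ, (i : WithBot ℕ∞) ≠ ringKrullDim S →
    Subsingleton ((localCohomology (IsLocalRing.maximalIdeal S) i).obj (ModuleCat.of S S))

/-- A local ring is Gorenstein if it has finite injective dimension over itself. -/
def IsGorensteinLocalRing (S : Type u) [CommRing S] : Prop :=
  injDim S (ModuleCat.of S S) ≠ ⊤

/-- The `a`-torsion submodule `Γ_a(M)` of `M`. -/
def idealTorsion (a : Ideal R) (M : Type u) [AddCommGroup M] [Module R M] :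
    Submodule R M :=
  ⨆ n : ℕ, Submodule.torsionBySet R M ((a ^ n : Ideal R) : Set R)

/-- The Krull dimension of a module, `dim_S N = dim (S / ann_S N)`. -/
def moduleKrullDim (S : Type u) [CommRing S] (N : Type u) [AddCommGroup N] [Module S N] :
    WithBot ℕ∞ :=
  ringKrullDim (S ⧸ Module.annihilator S N)

/-- `ht_M(a) = inf { dim_{R_p} M_p  |  p ∈ Supp (M / a M) }`. -/
def heightWRT (a : Ideal R) (M : Type u) [AddCommGroup M] [Module R M] : WithBot ℕ∞ :=
  ⨅ (p : PrimeSpectrum R) (_ : p ∈ Module.support R (M ⧸ (a • (⊤ : Submodule R M)))),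
    moduleKrullDim (Localization.AtPrime p.asIdeal) (LocalizedModule p.asIdeal.primeCompl M)

/-- Membership in the Bass class `B_C(R)`. -/
def MemBassClass (C M : ModuleCat.{u} R) : Prop :=
  (∀ i : ℕ, 1 ≤ i →
      Subsingleton (((Ext R (ModuleCat.{u} R) i).obj (Opposite.op C)).obj M)) ∧
  (∀ i : ℕ, 1 ≤ i →
      Subsingleton (((Tor (ModuleCat.{u} R) i).obj C).obj (ModuleCat.of R (C →ₗ[R] M)))) ∧
  Function.Bijective
    (TensorProduct.lift ((LinearMap.id : (C →ₗ[R] M) →ₗ[R] (C →ₗ[R] M)).flip))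

/-- Membership in the Auslander class `A_C(R)`. -/
def MemAuslanderClass (C M : ModuleCat.{u} R) : Prop :=
  (∀ i : ℕ, 1 ≤ i →
      Subsingleton (((Tor (ModuleCat.{u} R) i).obj C).obj M)) ∧
  (∀ i : ℕ, 1 ≤ i →
      Subsingleton (((Ext R (ModuleCat.{u} R) i).obj (Opposite.op C)).obj
        (ModuleCat.of R (↥C ⊗[R] ↥M)))) ∧
  Function.Bijective ((TensorProduct.mk R ↥C ↥M).flip)

/-- `HasResDimLE R P n M` : `M` admits a resolution of length at most `n`
by modules satisfying `P`. -/
def HasResDimLE (P : ModuleCat.{u} R → Prop) : ℕ → ModuleCat.{u} R → Prop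
  | 0, M => Subsingleton M ∨ P M
  | n + 1, M => Subsingleton M ∨ ∃ (X : ModuleCat.{u} R) (f : X →ₗ[R] M),
      P X ∧ Function.Surjective f ∧
        HasResDimLE P n (ModuleCat.of R ↥(LinearMap.ker f))

/-- The projective dimension of `M`. -/
def projDim (M : ModuleCat.{u} R) : ℕ∞ :=
  sInf {d : ℕ∞ | ∃ n : ℕ, d = n ∧ HasResDimLE R (fun N => Module.Projective R N) n M}

/-- The first projection of the trivial extension `R ⋉ C`, as a ring homomorphism. -/
def trivExtFst (C : Type u) [AddCommGroup C] [Module R C] [Module Rᵐᵒᵖ C]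
    [IsCentralScalar R C] : TrivSqZeroExt R C →+* R where
  toFun := TrivSqZeroExt.fst
  map_one' := TrivSqZeroExt.fst_one (R := R) (M := C)
  map_mul' := TrivSqZeroExt.fst_mul
  map_zero' := TrivSqZeroExt.fst_zero (R := R) (M := C)
  map_add' := TrivSqZeroExt.fst_add

/-- The ideal `a ⊕ C` of the trivial extension `R ⋉ C`. -/
def trivExtIdeal (a : Ideal R) (C : Type u) [AddCommGroup C] [Module R C] [Module Rᵐᵒᵖ C]
    [IsCentralScalar R C] : Ideal (TrivSqZeroExt R C) :=
  Ideal.comap (trivExtFst R C) a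

/-- An `R`-module `M`, viewed as a module over the trivial extension `R ⋉ C` via the
natural surjection `R ⋉ C → R`. -/
def trivExtModuleCat (C : Type u) [AddCommGroup C] [Module R C] [Module Rᵐᵒᵖ C]
    [IsCentralScalar R C] (M : Type u) [AddCommGroup M] [Module R M] :
    ModuleCat.{u} (TrivSqZeroExt R C) :=
  letI := Module.compHom M (trivExtFst R C)
  ModuleCat.of (TrivSqZeroExt R C) M

end

noncomputable section

open CategoryTheory Limits
universe w v u
variable {R : Type*} [CommRing R] {C : Type u} [Category.{v} C] [Abelian C] [Linear R C]

namespace CategoryTheory.ProjectiveResolution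
variable (R) in
/-- The complex `Hom(P, Y)` in the opposite category of `R`-modules. -/
abbrev yonedaOp {X : C} (P : ProjectiveResolution X) (Y : C) : ChainComplex (ModuleCat R)ᵒᵖ ℕ :=
  (((linearYoneda R C).obj Y).rightOp.mapHomologicalComplex _).obj P.complex

variable {X : C} (P : ProjectiveResolution X) (Y : C) (n : ℕ)

variable (R) in
/-- The inclusion of the `n`-cocycles of `Hom(P, Y)` into `Hom(Pₙ, Y)`. -/
def cocycleHom : ((P.yonedaOp R Y).opcycles n).unop →ₗ[R] (P.complex.X n ⟶ Y) :=
  ((P.yonedaOp R Y).pOpcycles n).unop.hom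

lemma d_cocycleHom (m : ℕ) (z) : P.complex.d m n ≫ P.cocycleHom R Y n z = 0 :=
  congr($(((P.yonedaOp R Y).d_pOpcycles m n)).unop z)

lemma cocycleHom_injective : Function.Injective (P.cocycleHom R Y n) :=
  (ModuleCat.mono_iff_injective ((P.yonedaOp R Y).pOpcycles n).unop).1 inferInstance

lemma exists_cocycleHom_eq (f : P.complex.X n ⟶ Y) (hf : P.complex.d (n + 1) n ≫ f = 0) :
    ∃ z, P.cocycleHom R Y n z = f := by
  have h := (ShortComplex.exact_of_g_is_cokernel
    (ShortComplex.mk _ _ ((P.yonedaOp R Y).d_pOpcycles (n + 1) n))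
    ((P.yonedaOp R Y).opcyclesIsCokernel (n + 1) n (by simp))).unop
  rw [ShortComplex.moduleCat_exact_iff] at h
  exact h f hf

variable [EnoughProjectives C]

variable (R) in
/-- `Ext` as the cohomology of `Hom(P, Y)`. -/
def extIsoUnop :
    ((Ext R C n).obj (.op X)).obj Y ≅ ((P.yonedaOp R Y).homology n).unop :=
  (P.isoLeftDerivedObj ((linearYoneda R C).obj Y).rightOp n).unop.symm

variable (R) in
/-- The class in `Ext R C n` of an `n`-cocycle of `Hom(P, Y)`. -/
def cocycleClass : ((P.yonedaOp R Y).opcycles n).unop ⟶ ((Ext R C n).obj (.op X)).obj Y :=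
  ((P.yonedaOp R Y).homologyι n).unop ≫ (P.extIsoUnop R Y n).inv

instance : Epi (P.cocycleClass R Y n) := by
  unfold cocycleClass
  have : Mono ((P.yonedaOp R Y).homologyι n) := inferInstance
  infer_instance

lemma cocycleClass_surjective : Function.Surjective (P.cocycleClass R Y n) :=
  (ModuleCat.epi_iff_surjective _).1 inferInstance

lemma cocycleClass_eq_zero_iff (m : ℕ) (hm : (ComplexShape.down ℕ).next n = m) (z) :
    P.cocycleClass R Y n z = 0 ↔
      ∃ g : P.complex.X m ⟶ Y, P.complex.d n m ≫ g = P.cocycleHom R Y n z := by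
  have h := (ShortComplex.exact_of_f_is_kernel
    (ShortComplex.mk _ _ ((P.yonedaOp R Y).homologyι_comp_fromOpcycles n m))
    ((P.yonedaOp R Y).homologyIsKernel n m hm)).unop
  rw [ShortComplex.moduleCat_exact_iff] at h
  have hp (g : P.complex.X m ⟶ Y) :
      P.cocycleHom R Y n (((P.yonedaOp R Y).fromOpcycles n m).unop g) = P.complex.d n m ≫ g :=
    congr($(((P.yonedaOp R Y).p_fromOpcycles n m)).unop g)
  have hi : P.cocycleClass R Y n z = 0 ↔ ((P.yonedaOp R Y).homologyι n).unop z = 0 :=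
    (P.extIsoUnop R Y n).symm.toLinearEquiv.map_eq_zero_iff
  rw [hi]
  constructor
  · intro hz
    obtain ⟨g, hg⟩ := h z hz
    exact ⟨g, (hp g).symm.trans congr(P.cocycleHom R Y n $hg)⟩
  · rintro ⟨g, hg⟩
    rw [← P.cocycleHom_injective Y n ((hp g).trans hg)]
    exact congr($(((P.yonedaOp R Y).homologyι_comp_fromOpcycles n m)).unop g)

lemma map_cocycleClass {Y Y' : C} (f : Y ⟶ Y') (z) (z')
    (h : P.cocycleHom R Y' n z' = P.cocycleHom R Y n z ≫ f) :
    ((Ext R C n).obj (.op X)).map f (P.cocycleClass R Y n z) = P.cocycleClass R Y' n z' := by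
  let α : P.yonedaOp R Y' ⟶ P.yonedaOp R Y :=
    (NatTrans.mapHomologicalComplex (NatTrans.rightOp ((linearYoneda R C).map f)) _).app P.complex
  have hz : (HomologicalComplex.opcyclesMap α n).unop z = z' := by
    apply P.cocycleHom_injective
    rw [h]
    exact congr($(HomologicalComplex.p_opcyclesMap α n).unop z)
  rw [← hz]
  have h1 : P.cocycleClass R Y n ≫ ((Ext R C n).obj (.op X)).map f =
      (HomologicalComplex.opcyclesMap α n).unop ≫ P.cocycleClass R Y' n := by
    have h2 : ((Ext R C n).obj (.op X)).map f = (P.extIsoUnop R Y n).hom ≫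
        (HomologicalComplex.homologyMap α n).unop ≫ (P.extIsoUnop R Y' n).inv :=
      congr($(P.leftDerived_app_eq (NatTrans.rightOp ((linearYoneda R C).map f)) n).unop).trans
        (Category.assoc _ _ _)
    rw [h2]
    unfold cocycleClass
    have h3 := congr($(HomologicalComplex.homologyι_naturality α n).unop)
    rw [unop_comp, unop_comp] at h3
    simp [reassoc_of% h3]
  exact congr($h1 z)

lemma map_op_cocycleClass {X' : C} {P : ProjectiveResolution X} {P' : ProjectiveResolution X'}
    {g : X' ⟶ X} (φ : Hom P' P g) (z) (z')
    (h : P'.cocycleHom R Y n z' = φ.hom.f n ≫ P.cocycleHom R Y n z) :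
    ((Ext R C n).map g.op).app Y (P.cocycleClass R Y n z) = P'.cocycleClass R Y n z' := by
  let α : P'.yonedaOp R Y ⟶ P.yonedaOp R Y :=
    (((linearYoneda R C).obj Y).rightOp.mapHomologicalComplex _).map φ.hom
  have hz : (HomologicalComplex.opcyclesMap α n).unop z = z' := by
    apply P'.cocycleHom_injective
    rw [h]
    exact congr($(HomologicalComplex.p_opcyclesMap α n).unop z)
  rw [← hz]
  have h1 : P.cocycleClass R Y n ≫ ((Ext R C n).map g.op).app Y =
      (HomologicalComplex.opcyclesMap α n).unop ≫ P'.cocycleClass R Y n := by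
    have h2 : (P.extIsoUnop R Y n).inv ≫ ((Ext R C n).map g.op).app Y =
        (HomologicalComplex.homologyMap α n).unop ≫ (P'.extIsoUnop R Y n).inv :=
      congr($(ProjectiveResolution.isoLeftDerivedObj_hom_naturality g P' P φ.hom
        (by have := φ.hom_f_zero_comp_π_f_zero; simpa using this)
        ((linearYoneda R C).obj Y).rightOp n).unop)
    unfold cocycleClass
    have h3 := congr($(HomologicalComplex.homologyι_naturality α n).unop)
    rw [unop_comp, unop_comp] at h3
    simp [reassoc_of% h3, h2]
  exact congr($h1 z)

section
variable [HasExt.{w} C]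
omit [EnoughProjectives C]

lemma extMk_eq_zero_iff_of_zero {Y : C} (f : P.complex.X 0 ⟶ Y) (hf : P.complex.d 1 0 ≫ f = 0) :
    P.extMk f 1 rfl hf = 0 ↔ f = 0 := by
  refine ⟨fun h ↦ ?_, by rintro rfl; simp⟩
  rw [← P.extEquivCohomologyClass.apply_eq_iff_eq, extEquivCohomologyClass_extMk,
    extEquivCohomologyClass_zero, CochainComplex.HomComplex.CohomologyClass.mk_eq_zero_iff,
    CochainComplex.HomComplex.Cocycle.toSingleMk_mem_coboundaries_iff _ _ _ _ _ 1 (by lia)] at h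
  obtain ⟨g, hg⟩ := h
  rw [(CochainComplex.isZero_of_isStrictlyLE P.cochainComplex 0 1).eq_of_src g 0, comp_zero] at hg
  rw [← cancel_epi (P.cochainComplexXIso (-0) 0).hom, comp_zero]
  exact hg.symm

lemma extMk_eq_zero_iff_next {Y : C} (f : P.complex.X n ⟶ Y) (hf : P.complex.d (n + 1) n ≫ f = 0)
    (m : ℕ) (hm : (ComplexShape.down ℕ).next n = m) :
    P.extMk f (n + 1) rfl hf = 0 ↔ ∃ g : P.complex.X m ⟶ Y, P.complex.d n m ≫ g = f := by
  subst hm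
  cases n with
  | zero =>
    rw [extMk_eq_zero_iff_of_zero]
    simp [eq_comm]
  | succ n =>
    have hm : (ComplexShape.down ℕ).next (n + 1) = n := by simp
    rw [hm]
    exact extMk_eq_zero_iff P f _ rfl hf n rfl

variable (R) in
/-- The class in `Abelian.Ext` of an `n`-cocycle of `Hom(P, Y)`. -/
def cocycleExt : ((P.yonedaOp R Y).opcycles n).unop →ₗ[R] Abelian.Ext.{w} X Y n where
  toFun z := P.extMk (P.cocycleHom R Y n z) (n + 1) rfl (P.d_cocycleHom Y n _ z)
  map_add' x y := by simp [add_extMk]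
  map_smul' r x := by
    rw [RingHom.id_apply, Abelian.Ext.smul_eq_comp_mk₀, extMk_comp_mk₀]
    simp

lemma cocycleExt_surjective : Function.Surjective (P.cocycleExt R Y n) := by
  intro e
  obtain ⟨f, hf, rfl⟩ := P.extMk_surjective e (n + 1) rfl
  obtain ⟨z, rfl⟩ := P.exists_cocycleHom_eq (R := R) Y n f hf
  exact ⟨z, rfl⟩

end

variable [HasExt.{w} C]

lemma ker_cocycleClass_eq :
    LinearMap.ker (P.cocycleClass R Y n).hom = LinearMap.ker (P.cocycleExt R Y n) := by
  ext z
  exact (P.cocycleClass_eq_zero_iff Y n _ rfl z).trans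
    (P.extMk_eq_zero_iff_next n _ (P.d_cocycleHom Y n _ z) _ rfl).symm

variable (R) in
/-- The derived functor `Ext R C n` agrees with `Abelian.Ext`. -/
def extEquiv : ((Ext R C n).obj (.op X)).obj Y ≃ₗ[R] Abelian.Ext.{w} X Y n :=
  ((P.cocycleClass R Y n).hom.quotKerEquivOfSurjective (P.cocycleClass_surjective Y n)).symm ≪≫ₗ
    Submodule.quotEquivOfEq _ _ (P.ker_cocycleClass_eq Y n) ≪≫ₗ
      (P.cocycleExt R Y n).quotKerEquivOfSurjective (P.cocycleExt_surjective Y n)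

lemma extEquiv_cocycleClass (z) :
    P.extEquiv R Y n (P.cocycleClass R Y n z) = P.cocycleExt R Y n z := by
  have : ((P.cocycleClass R Y n).hom.quotKerEquivOfSurjective
      (P.cocycleClass_surjective Y n)).symm (P.cocycleClass R Y n z) = Submodule.Quotient.mk z := by
    rw [LinearEquiv.symm_apply_eq]; rfl
  unfold extEquiv
  rw [LinearEquiv.trans_apply, LinearEquiv.trans_apply, this]
  rfl

lemma extEquiv_map {Y Y' : C} (f : Y ⟶ Y') (x : ((Ext R C n).obj (.op X)).obj Y) :
    P.extEquiv R Y' n (((Ext R C n).obj (.op X)).map f x) =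
      (P.extEquiv R Y n x).comp (Abelian.Ext.mk₀ f) (add_zero n) := by
  obtain ⟨z, rfl⟩ := P.cocycleClass_surjective Y n x
  obtain ⟨z', hz'⟩ := P.exists_cocycleHom_eq (R := R) Y' n (P.cocycleHom R Y n z ≫ f)
    (by rw [← Category.assoc, P.d_cocycleHom, zero_comp])
  rw [P.map_cocycleClass n f z z' hz', extEquiv_cocycleClass, extEquiv_cocycleClass]
  dsimp [cocycleExt]
  rw [extMk_comp_mk₀]
  congr

lemma extEquiv_map_op {X' : C} {P : ProjectiveResolution X} {P' : ProjectiveResolution X'}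
    (g : X' ⟶ X) (x : ((Ext R C n).obj (.op X)).obj Y) :
    P'.extEquiv R Y n (((Ext R C n).map g.op).app Y x) =
      (Abelian.Ext.mk₀ g).comp (P.extEquiv R Y n x) (zero_add n) := by
  let φ : Hom P' P g := ⟨lift g P' P, HomologicalComplex.congr_hom (lift_commutes g P' P) 0⟩
  obtain ⟨z, rfl⟩ := P.cocycleClass_surjective Y n x
  obtain ⟨z', hz'⟩ := P'.exists_cocycleHom_eq (R := R) Y n (φ.hom.f n ≫ P.cocycleHom R Y n z)
    (by rw [← φ.hom.comm_assoc, P.d_cocycleHom, comp_zero])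
  rw [map_op_cocycleClass Y n φ z z' hz', extEquiv_cocycleClass, extEquiv_cocycleClass]
  dsimp [cocycleExt]
  rw [mk₀_comp_extMk _ _ _ _ φ]
  congr

end CategoryTheory.ProjectiveResolution

end

noncomputable section

open CategoryTheory Limits TensorProduct
universe u
namespace localCohomology
variable {R : Type u} [CommRing R] (J : Ideal R) (i : ℕ)

/-- The quotient module `R ⧸ J ^ n`. -/
abbrev quotPow (n : ℕ) : ModuleCat.{u} R := ModuleCat.of R (R ⧸ J ^ n)

variable {J} in
/-- The projection `R ⧸ J ^ k → R ⧸ J ^ n` for `n ≤ k`. -/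
abbrev transition {n k : ℕ} (h : n ≤ k) : quotPow J k ⟶ quotPow J n :=
  (ringModIdeals (idealPowersDiagram J)).map (homOfLE h).op

variable (N : ModuleCat.{u} R)

instance : PreservesColimitsOfShape ℕᵒᵖᵒᵖ (forget (ModuleCat.{u} R)) :=
  have := preservesFilteredColimitsOfSize_shrink.{0, u, 0, u} (forget (ModuleCat.{u} R))
  inferInstance

/-- The evaluation at `N` of the colimit cocone defining local cohomology. -/
def isColimitEvaluation : IsColimit (((evaluation _ _).obj N).mapCocone
    (colimit.cocone (diagram (idealPowersDiagram J) i))) :=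
  isColimitOfPreserves _ (colimit.isColimit _)

/-- The structure map from `Ext R (R ⧸ J ^ n) N` to local cohomology. -/
def structureMap (n : ℕ) : ((Ext R (ModuleCat.{u} R) i).obj (.op (quotPow J n))).obj N ⟶
    (localCohomology J i).obj N :=
  (colimit.ι (diagram (idealPowersDiagram J) i) (.op (.op n))).app N

/-- The map from `Ext (R ⧸ J ^ n) N i` to local cohomology. -/
def ofExt (n : ℕ) : Abelian.Ext.{u} (quotPow J n) N i →ₗ[R] (localCohomology J i).obj N :=
  (structureMap J i N n).hom ∘ₗ
    ((projectiveResolution (quotPow J n)).extEquiv R N i).symm.toLinearMap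

lemma ofExt_extEquiv (n : ℕ) (P : ProjectiveResolution (quotPow J n)) (x) :
    ofExt J i N n (P.extEquiv R N i x) = structureMap J i N n x := by
  have : P.extEquiv R N i x = (projectiveResolution (quotPow J n)).extEquiv R N i x := by
    have := ProjectiveResolution.extEquiv_map_op i (Y := N)
      (P := projectiveResolution (quotPow J n)) (P' := P) (𝟙 _) x
    simpa using this
  rw [this]
  exact congr(structureMap J i N n $(LinearEquiv.symm_apply_apply _ _))

lemma ofExt_surjective (x : (localCohomology J i).obj N) : ∃ n e, ofExt J i N n e = x := by
  obtain ⟨j, y, hy⟩ := Concrete.isColimit_exists_rep _ (isColimitEvaluation J i N) x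
  exact ⟨j.unop.unop, (projectiveResolution _).extEquiv R N i y,
    (ofExt_extEquiv J i N _ _ y).trans hy⟩

variable {N} in
lemma map_ofExt {N' : ModuleCat.{u} R} (f : N ⟶ N') (n : ℕ) (e) :
    (localCohomology J i).map f (ofExt J i N n e) =
      ofExt J i N' n (e.comp (Abelian.Ext.mk₀ f) (add_zero i)) := by
  obtain ⟨x, rfl⟩ := ((projectiveResolution (quotPow J n)).extEquiv R N i).surjective e
  rw [← ProjectiveResolution.extEquiv_map, ofExt_extEquiv, ofExt_extEquiv]
  exact congr($((colimit.ι (diagram (idealPowersDiagram J) i) (.op (.op n))).naturality f) x).symm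

variable {J} in
lemma ofExt_transition {n k : ℕ} (h : n ≤ k) (e) :
    ofExt J i N k ((Abelian.Ext.mk₀ (transition (J := J) h)).comp e (zero_add i)) =
      ofExt J i N n e := by
  obtain ⟨x, rfl⟩ := ((projectiveResolution (quotPow J n)).extEquiv R N i).surjective e
  rw [← ProjectiveResolution.extEquiv_map_op (P' := projectiveResolution _), ofExt_extEquiv,
    ofExt_extEquiv]
  exact congr($(colimit.w (diagram (idealPowersDiagram J) i) (homOfLE h).op.op).app N x)

lemma structureMap_eq_zero (n : ℕ) (x) (hx : structureMap J i N n x = 0) :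
    ∃ k, ∃ h : n ≤ k, ((Ext R (ModuleCat.{u} R) i).map (transition (J := J) h).op).app N x = 0 := by
  let F := diagram (idealPowersDiagram J) i ⋙ (evaluation _ _).obj N
  let x' : F.obj (.op (.op n)) := x
  have h := Concrete.isColimit_exists_of_rep_eq F (isColimitEvaluation J i N) x'
    (0 : F.obj (.op (.op n)))
  have h0 : structureMap J i N n x = structureMap J i N n 0 :=
    hx.trans (map_zero (structureMap J i N n).hom).symm
  obtain ⟨k, f, g, hk⟩ := h h0
  exact ⟨k.unop.unop, leOfHom f.unop.unop, hk.trans (map_zero (F.map g).hom)⟩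

lemma ofExt_eq_zero_iff (n : ℕ) (e) : ofExt J i N n e = 0 ↔
    ∃ k, ∃ h : n ≤ k, (Abelian.Ext.mk₀ (transition (J := J) h)).comp e (zero_add i) = 0 := by
  refine ⟨fun he ↦ ?_, fun ⟨k, h, he⟩ ↦ by rw [← ofExt_transition i N h, he, map_zero]⟩
  obtain ⟨x, rfl⟩ := ((projectiveResolution (quotPow J n)).extEquiv R N i).surjective e
  rw [ofExt_extEquiv] at he
  obtain ⟨k, h, hk⟩ := structureMap_eq_zero J i N n x he
  refine ⟨k, h, ?_⟩
  rw [← ProjectiveResolution.extEquiv_map_op (P' := projectiveResolution _), hk, map_zero]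

end localCohomology

end

noncomputable section

open CategoryTheory Limits TensorProduct
universe u
namespace localCohomology
variable {R : Type u} [CommRing R] (J : Ideal R) (i : ℕ)

section exactness
variable {S : ShortComplex (ModuleCat.{u} R)} (hS : S.ShortExact)
include hS

lemma exact_of_shortExact : Function.Exact
    ((localCohomology J i).map S.f) ((localCohomology J i).map S.g) := by
  intro x
  constructor
  · intro hx
    obtain ⟨n, e, rfl⟩ := ofExt_surjective J i _ x
    rw [map_ofExt, ofExt_eq_zero_iff] at hx
    obtain ⟨k, h, hx⟩ := hx
    rw [← Abelian.Ext.comp_assoc_of_third_deg_zero] at hx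
    obtain ⟨y, hy⟩ := Abelian.Ext.covariant_sequence_exact₂ _ hS _ hx
    refine ⟨ofExt J i _ k y, ?_⟩
    rw [map_ofExt, hy, ofExt_transition]
  · rintro ⟨y, rfl⟩
    rw [← ConcreteCategory.comp_apply, ← Functor.map_comp, S.zero]
    obtain ⟨n, e, rfl⟩ := ofExt_surjective J i _ y
    rw [map_ofExt, Abelian.Ext.mk₀_zero, Abelian.Ext.comp_zero, map_zero]

lemma map_surjective_of_shortExact
    [Subsingleton ((localCohomology J (i + 1)).obj S.X₁)] :
    Function.Surjective ((localCohomology J i).map S.g) := by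
  intro x
  obtain ⟨n, e, rfl⟩ := ofExt_surjective J i _ x
  obtain ⟨k, h, hk⟩ := (ofExt_eq_zero_iff J (i + 1) S.X₁ n (e.comp hS.extClass rfl)).1
    (Subsingleton.elim _ _)
  rw [← Abelian.Ext.comp_assoc _ _ _ (zero_add i) rfl (by lia)] at hk
  obtain ⟨y, hy⟩ := Abelian.Ext.covariant_sequence_exact₃ _ hS _ _ hk
  exact ⟨ofExt J i _ k y, by rw [map_ofExt, hy, ofExt_transition]⟩

lemma exists_ofExt_comp_extClass (x : (localCohomology J (i + 1)).obj S.X₁)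
    (hx : (localCohomology J (i + 1)).map S.f x = 0) :
    ∃ n, ∃ e : Abelian.Ext.{u} (quotPow J n) S.X₃ i,
      ofExt J (i + 1) _ n (e.comp hS.extClass rfl) = x := by
  obtain ⟨n, e, rfl⟩ := ofExt_surjective J _ _ x
  rw [map_ofExt, ofExt_eq_zero_iff] at hx
  obtain ⟨k, h, hx⟩ := hx
  rw [← Abelian.Ext.comp_assoc_of_third_deg_zero] at hx
  obtain ⟨y, hy⟩ := Abelian.Ext.covariant_sequence_exact₁ _ hS _ hx rfl
  exact ⟨k, y, by rw [hy, ofExt_transition]⟩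

lemma map_injective_of_shortExact [Subsingleton ((localCohomology J i).obj S.X₃)] :
    Function.Injective ((localCohomology J (i + 1)).map S.f) := by
  refine (injective_iff_map_eq_zero ((localCohomology J (i + 1)).map S.f).hom).2 fun x hx ↦ ?_
  obtain ⟨n, e, rfl⟩ := exists_ofExt_comp_extClass J i hS x hx
  obtain ⟨k, h, hk⟩ := (ofExt_eq_zero_iff J i _ n e).1 (Subsingleton.elim _ _)
  rw [ofExt_eq_zero_iff]
  exact ⟨k, h, by rw [← Abelian.Ext.comp_assoc _ _ _ (zero_add i) rfl (by lia), hk,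
    Abelian.Ext.zero_comp]⟩

end exactness

section linear
variable {N N' : ModuleCat.{u} R}

lemma map_add_apply (f g : N ⟶ N') (x : (localCohomology J i).obj N) :
    (localCohomology J i).map (f + g) x =
      (localCohomology J i).map f x + (localCohomology J i).map g x := by
  obtain ⟨n, e, rfl⟩ := ofExt_surjective J i _ x
  simp [map_ofExt, Abelian.Ext.mk₀_add, Abelian.Ext.comp_add]

lemma map_smul_apply (r : R) (f : N ⟶ N') (x : (localCohomology J i).obj N) :
    (localCohomology J i).map (r • f) x = r • (localCohomology J i).map f x := by
  obtain ⟨n, e, rfl⟩ := ofExt_surjective J i _ x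
  simp [map_ofExt, Abelian.Ext.mk₀_smul, Abelian.Ext.comp_smul]

instance [Subsingleton N] : Subsingleton ((localCohomology J i).obj N) := by
  have h : 𝟙 N = (0 : R) • 𝟙 N := (ModuleCat.isZero_of_subsingleton N).eq_of_src _ _
  refine ⟨fun x y ↦ ?_⟩
  have key (x) : x = (0 : (localCohomology J i).obj N) := by
    have := map_smul_apply J i (0 : R) (𝟙 N) x
    rw [← h] at this
    simpa using this
  rw [key x, key y]

lemma exists_pow_smul_eq_zero (x : (localCohomology J i).obj N) :
    ∃ n, ∀ r ∈ J ^ n, r • x = 0 := by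
  obtain ⟨n, e, rfl⟩ := ofExt_surjective J i _ x
  refine ⟨n, fun r hr ↦ ?_⟩
  have h : r • 𝟙 (quotPow J n) = 0 := by
    refine ModuleCat.hom_ext (LinearMap.ext fun x ↦ ?_)
    obtain ⟨x, rfl⟩ := Ideal.Quotient.mk_surjective x
    exact Ideal.Quotient.eq_zero_iff_mem.2 (Ideal.mul_mem_right _ _ hr)
  have h' : r • e = 0 := by
    rw [← Abelian.Ext.mk₀_id_comp e, ← Abelian.Ext.smul_comp, ← Abelian.Ext.mk₀_smul, h,
      Abelian.Ext.mk₀_zero, Abelian.Ext.zero_comp]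
  rw [← map_smul, h', map_zero]

end linear

end localCohomology

end

noncomputable section

open CategoryTheory Limits TensorProduct
universe u

section torsion
variable {R : Type u} [CommRing R] (J : Ideal R) (M : Type u) [AddCommGroup M] [Module R M]

/-- The submodule of elements killed by a power of `J`. -/
def powTorsion : Submodule R M where
  carrier := {x | ∃ n, ∀ r ∈ J ^ n, r • x = 0}
  zero_mem' := ⟨0, by simp⟩
  add_mem' := by
    rintro x y ⟨n, hn⟩ ⟨k, hk⟩
    refine ⟨n + k, fun r hr ↦ ?_⟩
    rw [smul_add, hn r (Ideal.pow_le_pow_right (by lia) hr),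
      hk r (Ideal.pow_le_pow_right (by lia) hr), add_zero]
  smul_mem' := by
    rintro c x ⟨n, hn⟩
    exact ⟨n, fun r hr ↦ by rw [smul_comm, hn r hr, smul_zero]⟩

variable {M} in
lemma exists_pow_smul_eq_zero_of_fg {N : Submodule R M} (hN : N.FG) (h : N ≤ powTorsion J M) :
    ∃ n, ∀ x ∈ N, ∀ r ∈ J ^ n, r • x = 0 := by
  induction N, hN using Submodule.fg_induction with
  | singleton x =>
    obtain ⟨n, hn⟩ := h (Submodule.mem_span_singleton_self x)
    refine ⟨n, fun y hy r hr ↦ ?_⟩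
    obtain ⟨a, rfl⟩ := Submodule.mem_span_singleton.1 hy
    rw [smul_comm, hn r hr, smul_zero]
  | sup N₁ N₂ _ _ h₁ h₂ =>
    obtain ⟨n, hn⟩ := h₁ (le_sup_left.trans h)
    obtain ⟨k, hk⟩ := h₂ (le_sup_right.trans h)
    refine ⟨n + k, fun y hy r hr ↦ ?_⟩
    obtain ⟨a, ha, b, hb, rfl⟩ := Submodule.mem_sup.1 hy
    rw [smul_add, hn a ha r (Ideal.pow_le_pow_right (by lia) hr),
      hk b hb r (Ideal.pow_le_pow_right (by lia) hr), add_zero]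

lemma exists_isSMulRegular_quotient_powTorsion [IsNoetherianRing R] [Module.Finite R M] :
    ∃ x ∈ J, IsSMulRegular (M ⧸ powTorsion J M) x := by
  have h : Subsingleton ((R ⧸ J) →ₗ[R] (M ⧸ powTorsion J M)) := by
    refine subsingleton_of_forall_eq 0 fun f ↦ ?_
    ext
    obtain ⟨y, hy⟩ := Submodule.Quotient.mk_surjective _ (f 1)
    have hJ : ∀ r ∈ J, r • y ∈ powTorsion J M := fun r hr ↦ by
      rw [← Submodule.Quotient.mk_eq_zero, Submodule.Quotient.mk_smul, hy, ← map_smul]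
      convert map_zero f
      rw [Algebra.smul_def, mul_one]
      exact Ideal.Quotient.eq_zero_iff_mem.2 hr
    have hle : J • Submodule.span R {y} ≤ powTorsion J M := by
      refine Submodule.smul_le.2 fun r hr z hz ↦ ?_
      obtain ⟨a, rfl⟩ := Submodule.mem_span_singleton.1 hz
      rw [smul_comm]
      exact Submodule.smul_mem _ _ (hJ r hr)
    obtain ⟨n, hn⟩ := exists_pow_smul_eq_zero_of_fg J (IsNoetherian.noetherian _) hle
    have : y ∈ powTorsion J M := by
      refine ⟨n + 1, fun r hr ↦ ?_⟩
      rw [pow_succ] at hr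
      refine Submodule.mul_induction_on hr (fun a ha b hb ↦ ?_) fun a b ha hb ↦ by
        rw [add_smul, ha, hb, add_zero]
      rw [mul_smul]
      exact hn _ (Submodule.smul_mem_smul hb (Submodule.mem_span_singleton_self y)) a ha
    simpa [← hy] using this
  obtain ⟨x, hx, hr⟩ := IsSMulRegular.subsingleton_linearMap_iff.1 h
  exact ⟨x, by simpa [Ideal.annihilator_quotient] using hx, hr⟩

variable {M} in
/-- Extension of a linear map along a not necessarily injective map. -/
lemma Module.Injective.exists_comp_eq {A B E : Type u} [AddCommGroup A] [Module R A]
    [AddCommGroup B] [Module R B] [AddCommGroup E] [Module R E] [Module.Injective R E]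
    (φ : A →ₗ[R] B) (g : A →ₗ[R] E) (h : LinearMap.ker φ ≤ LinearMap.ker g) :
    ∃ f : B →ₗ[R] E, f ∘ₗ φ = g := by
  obtain ⟨f, hf⟩ := Module.Injective.out ((LinearMap.ker φ).liftQ φ le_rfl)
    (LinearMap.ker_eq_bot.1 (Submodule.ker_liftQ_eq_bot _ _ _ le_rfl))
    ((LinearMap.ker φ).liftQ g h)
  exact ⟨f, LinearMap.ext fun a ↦ hf (Submodule.Quotient.mk a)⟩

instance [IsNoetherianRing R] [Module.Injective R M] : Module.Injective R (powTorsion J M) := by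
  apply Module.Baer.injective
  intro I g
  obtain ⟨n, hn⟩ := exists_pow_smul_eq_zero_of_fg J (N := LinearMap.range ((powTorsion J M).subtype ∘ₗ g))
    (by rw [LinearMap.range_eq_map]; exact (IsNoetherian.noetherian _).map _)
    (by rintro _ ⟨x, rfl⟩; exact (g x).2)
  obtain ⟨k, hk⟩ := Ideal.exists_pow_inf_eq_pow_smul J I
  obtain ⟨f, hf⟩ := Module.Injective.exists_comp_eq ((J ^ (n + k)).mkQ ∘ₗ I.subtype)
    ((powTorsion J M).subtype ∘ₗ g) (by
      intro x hx
      have hxJ : (x : R) ∈ J ^ (n + k) :=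
        Ideal.Quotient.eq_zero_iff_mem.1 hx
      have hle : J ^ n • I ≤
          (LinearMap.ker ((powTorsion J M).subtype ∘ₗ g)).map I.subtype := by
        refine Submodule.smul_le.2 fun r hr y hy ↦ ⟨r • ⟨y, hy⟩, ?_, rfl⟩
        rw [SetLike.mem_coe, LinearMap.mem_ker, map_smul]
        exact hn _ (LinearMap.mem_range_self _ _) r hr
      have hmem : (x : R) ∈ J ^ (n + k) • (⊤ : Submodule R R) ⊓ I := ⟨by simpa using hxJ, x.2⟩
      rw [hk (n + k) (by lia), Nat.add_sub_cancel] at hmem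
      obtain ⟨y, hy, hyx⟩ := hle (Submodule.smul_mono le_rfl inf_le_right hmem)
      rwa [← Subtype.ext hyx])
  have hf' (r : R) : f (Submodule.Quotient.mk r) ∈ powTorsion J M := by
    refine ⟨n + k, fun s hs ↦ ?_⟩
    rw [← map_smul, ← Submodule.Quotient.mk_smul, (Submodule.Quotient.mk_eq_zero _).2, map_zero]
    exact Ideal.mul_mem_right _ _ hs
  exact ⟨(f ∘ₗ (J ^ (n + k)).mkQ).codRestrict _ hf', fun x hx ↦ Subtype.ext congr($hf ⟨x, hx⟩)⟩

end torsion

namespace localCohomology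
variable {R : Type u} [CommRing R] [IsNoetherianRing R] (J : Ideal R)

omit [IsNoetherianRing R] in
lemma shortExact_of_submodule {M : Type u} [AddCommGroup M] [Module R M] (N : Submodule R M) :
    (ShortComplex.mk (ModuleCat.ofHom N.subtype) (ModuleCat.ofHom N.mkQ)
      (ModuleCat.hom_ext (LinearMap.ext fun x ↦ by simp))).ShortExact :=
  ModuleCat.shortComplex_shortExact _
    (LinearMap.exact_subtype_mkQ N) N.injective_subtype N.mkQ_surjective

instance subsingleton_of_injective (i : ℕ) (E : ModuleCat.{u} R) [Injective E] :
    Subsingleton ((localCohomology J (i + 1)).obj E) := by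
  refine subsingleton_of_forall_eq 0 fun x ↦ ?_
  obtain ⟨n, e, rfl⟩ := ofExt_surjective J _ _ x
  rw [e.eq_zero_of_injective, map_zero]

variable {J} in
/-- The map `R ⧸ J ^ n → E` sending `1` to `x`. -/
def homOfMem {E : Type u} [AddCommGroup E] [Module R E] (x : E) (n : ℕ)
    (h : ∀ r ∈ J ^ n, r • x = 0) : quotPow J n ⟶ ModuleCat.of R E :=
  ModuleCat.ofHom ((J ^ n).liftQ (LinearMap.toSpanSingleton R E x) h)

lemma subsingleton_of_torsion (i : ℕ) : ∀ (T : Type u) [AddCommGroup T] [Module R T],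
    powTorsion J T = ⊤ → Subsingleton ((localCohomology J (i + 1)).obj (ModuleCat.of R T)) := by
  have key : ∀ (T : Type u) [AddCommGroup T] [Module R T], powTorsion J T = ⊤ →
      ∃ (E : Type u) (_ : AddCommGroup E) (_ : Module R E) (N : Submodule R E),
        Module.Injective R E ∧ powTorsion J E = ⊤ ∧ Nonempty (T ≃ₗ[R] N) := by
    intro T _ _ hT
    obtain ⟨⟨E, hE, f, hf⟩⟩ := EnoughInjectives.presentation (ModuleCat.of R T)
    have : Module.Injective R E := (Module.injective_iff_injective_object R E).2 hE
    have hf' : Function.Injective f := (ModuleCat.mono_iff_injective f).1 hf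
    let g : T →ₗ[R] powTorsion J E := f.hom.codRestrict _ fun x ↦ by
      obtain ⟨n, hn⟩ := (hT ▸ Submodule.mem_top : x ∈ powTorsion J T)
      exact ⟨n, fun r hr ↦ by rw [← map_smul, hn r hr, map_zero]⟩
    refine ⟨powTorsion J E, inferInstance, inferInstance, LinearMap.range g, inferInstance, ?_,
      ⟨LinearEquiv.ofInjective g fun x y h ↦ hf' congr(($h).1)⟩⟩
    refine eq_top_iff.2 fun x _ ↦ ?_
    obtain ⟨n, hn⟩ := x.2
    exact ⟨n, fun r hr ↦ Subtype.ext (hn r hr)⟩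
  have hq : ∀ {E : Type u} [AddCommGroup E] [Module R E] (N : Submodule R E),
      powTorsion J E = ⊤ → powTorsion J (E ⧸ N) = ⊤ := by
    refine fun {E} _ _ N hE ↦ eq_top_iff.2 fun x _ ↦ ?_
    obtain ⟨x, rfl⟩ := Submodule.Quotient.mk_surjective _ x
    obtain ⟨n, hn⟩ := (hE ▸ Submodule.mem_top : x ∈ powTorsion J E)
    exact ⟨n, fun r hr ↦ by rw [← Submodule.Quotient.mk_smul, hn r hr, Submodule.Quotient.mk_zero]⟩
  induction i with
  | zero =>
    intro T _ _ hT
    obtain ⟨E, _, _, N, hE, hE', ⟨e⟩⟩ := key T hT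
    suffices Subsingleton ((localCohomology J (0 + 1)).obj (ModuleCat.of R N)) from
      ((localCohomology J (0 + 1)).mapIso e.toModuleIso).toLinearEquiv.toEquiv.subsingleton
    have : Injective (ModuleCat.of R E) := (Module.injective_iff_injective_object R E).1 hE
    refine subsingleton_of_forall_eq 0 fun x ↦ ?_
    obtain ⟨n, e, rfl⟩ := exists_ofExt_comp_extClass J 0 (shortExact_of_submodule N) x
      (@Subsingleton.elim _ (subsingleton_of_injective J 0 (ModuleCat.of R E)) _ _)
    obtain ⟨φ, rfl⟩ := (Abelian.Ext.mk₀_bijective _ _).2 e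
    obtain ⟨y, hy⟩ := N.mkQ_surjective (φ (1 : R ⧸ J ^ n))
    obtain ⟨k, hk⟩ := (hE' ▸ Submodule.mem_top : y ∈ powTorsion J E)
    have hk' : ∀ r ∈ J ^ (n + k), r • y = 0 := fun r hr ↦
      hk r (Ideal.pow_le_pow_right (by lia) hr)
    rw [ofExt_eq_zero_iff]
    refine ⟨n + k, Nat.le_add_right n k, ?_⟩
    have : transition (J := J) (Nat.le_add_right n k) ≫ φ =
        homOfMem y (n + k) hk' ≫ ModuleCat.ofHom N.mkQ := by
      refine ModuleCat.hom_ext (LinearMap.ext fun r ↦ ?_)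
      obtain ⟨r, rfl⟩ := Ideal.Quotient.mk_surjective r
      change φ (Ideal.Quotient.mk _ r) = N.mkQ (r • y)
      rw [map_smul, hy, ← map_smul]
      congr 1
      simp [Algebra.smul_def]
    rw [← Abelian.Ext.comp_assoc _ _ _ (zero_add 0) rfl (by lia), Abelian.Ext.mk₀_comp_mk₀, this,
      ← Abelian.Ext.mk₀_comp_mk₀, Abelian.Ext.comp_assoc _ _ _ _ (zero_add 1) (by lia),
      (shortExact_of_submodule N).comp_extClass, Abelian.Ext.comp_zero]
  | succ i ih =>
    intro T _ _ hT
    obtain ⟨E, _, _, N, hE, hE', ⟨e⟩⟩ := key T hT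
    suffices Subsingleton ((localCohomology J (i + 1 + 1)).obj (ModuleCat.of R N)) from
      ((localCohomology J (i + 1 + 1)).mapIso e.toModuleIso).toLinearEquiv.toEquiv.subsingleton
    have := ih (E ⧸ N) (hq N hE')
    have : Injective (ModuleCat.of R E) := (Module.injective_iff_injective_object R E).1 hE
    have : Subsingleton ((localCohomology J (i + 1 + 1)).obj (ModuleCat.of R E)) := inferInstance
    exact (map_injective_of_shortExact J (i + 1) (shortExact_of_submodule N)).subsingleton

omit [IsNoetherianRing R] in
lemma subsingleton_of_isSMulRegular (i : ℕ) {M : ModuleCat.{u} R} {x : R} (hx : x ∈ J)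
    (hreg : IsSMulRegular M x)
    [Subsingleton ((localCohomology J i).obj (ModuleCat.of R (QuotSMulTop x M)))] :
    Subsingleton ((localCohomology J (i + 1)).obj M) := by
  have : Subsingleton ((localCohomology J i).obj (M.smulShortComplex x).X₃) := by assumption
  have hinj : Function.Injective ((localCohomology J (i + 1)).map (x • 𝟙 M)) :=
    map_injective_of_shortExact J i hreg.smulShortComplex_shortExact
  refine subsingleton_of_forall_eq 0 fun y ↦ ?_
  obtain ⟨n, hn⟩ := exists_pow_smul_eq_zero J _ y
  have h (z : (localCohomology J (i + 1)).obj M) (hz : x • z = 0) : z = 0 :=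
    hinj (by rw [map_smul_apply, map_smul_apply, CategoryTheory.Functor.map_id,
      ConcreteCategory.id_apply, ConcreteCategory.id_apply, hz, smul_zero])
  have h' (k : ℕ) (hk : x ^ k • y = 0) : y = 0 := by
    induction k with
    | zero => simpa using hk
    | succ k ih => exact ih (h _ (by rwa [smul_smul, ← pow_succ']))
  exact h' n (hn _ (Ideal.pow_mem_pow hx n))

/-- Grothendieck vanishing for local cohomology. -/
lemma subsingleton_of_supportDim_lt (i : ℕ) : ∀ (M : Type u) [AddCommGroup M] [Module R M]
    [Module.Finite R M], Module.supportDim R M < i →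
      Subsingleton ((localCohomology J i).obj (ModuleCat.of R M)) := by
  induction i with
  | zero =>
    intro M _ _ _ h
    have : Subsingleton (ModuleCat.of R M) := by
      by_contra hM
      have : Nontrivial M := not_subsingleton_iff_nontrivial.1 hM
      exact Module.supportDim_ne_bot_of_nontrivial R M (WithBot.lt_coe_bot.1 h)
    infer_instance
  | succ i ih =>
    intro M _ _ _ h
    have hT : powTorsion J (powTorsion J M) = ⊤ := eq_top_iff.2 fun x _ ↦
      have ⟨n, hn⟩ := x.2
      ⟨n, fun r hr ↦ Subtype.ext (hn r hr)⟩
    have := subsingleton_of_torsion J i (powTorsion J M) hT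
    have hex := exact_of_shortExact J (i + 1) (shortExact_of_submodule (powTorsion J M))
    obtain ⟨x, hx, hreg⟩ := exists_isSMulRegular_quotient_powTorsion J M
    have hle := Module.supportDim_le_of_surjective (powTorsion J M).mkQ
      (powTorsion J M).mkQ_surjective
    have := ih (QuotSMulTop x (M ⧸ powTorsion J M)) (by
      have h1 := Module.supportDim_quotSMulTop_succ_le_of_notMem_minimalPrimes
        (M := M ⧸ powTorsion J M) (fun _ ↦ hreg.notMem_of_mem_minimalPrimes)
      have h2 := (h1.trans hle).trans_lt h
      push_cast at h2
      exact lt_of_add_lt_add_right h2)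
    have : Subsingleton ((localCohomology J (i + 1)).obj (ModuleCat.of R (M ⧸ powTorsion J M))) :=
      subsingleton_of_isSMulRegular J i (M := ModuleCat.of R (M ⧸ powTorsion J M)) hx hreg
    refine subsingleton_of_forall_eq 0 fun y ↦ ?_
    obtain ⟨z, rfl⟩ := (hex y).1 (Subsingleton.elim (α := (localCohomology J (i + 1)).obj (ModuleCat.of R (M ⧸ powTorsion J M))) _ _)
    rw [Subsingleton.elim (α := (localCohomology J (i + 1)).obj (ModuleCat.of R (powTorsion J M))) z 0]
    exact map_zero ((localCohomology J (i + 1)).map (ModuleCat.ofHom (powTorsion J M).subtype)).hom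

end localCohomology

end

noncomputable section

open CategoryTheory TensorProduct
universe u

section comparison
variable {R : Type u} [CommRing R]

/-- A functor on `R`-modules is right exact on finitely generated modules. -/
def IsRightExactOnFinite (G : ModuleCat.{u} R ⥤ ModuleCat.{u} R) : Prop :=
  ∀ ⦃A B D : ModuleCat.{u} R⦄ (f : A ⟶ B) (g : B ⟶ D), Module.Finite R A → Module.Finite R B →
    Module.Finite R D → Function.Exact f g → Function.Surjective g →
    Function.Exact (G.map f) (G.map g) ∧ Function.Surjective (G.map g)

variable {G : ModuleCat.{u} R ⥤ ModuleCat.{u} R} {X : Type u} [AddCommGroup X] [Module R X]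
  (τ : ∀ A : ModuleCat.{u} R, A ⊗[R] X →ₗ[R] G.obj A)

include τ in
/-- A natural transformation `- ⊗ X ⟶ G` to an additive functor that is bijective at `R` is
bijective at finite free modules. -/
lemma bijective_pi_of_bijective_self [G.Additive]
    (hτ : ∀ ⦃A B : ModuleCat.{u} R⦄ (f : A ⟶ B) (z : A ⊗[R] X),
      G.map f (τ A z) = τ B (f.hom.rTensor X z))
    (h : Function.Bijective (τ (ModuleCat.of R R))) (n : ℕ) :
    Function.Bijective (τ (ModuleCat.of R (Fin n → R))) := by
  let s (j : Fin n) : ModuleCat.of R R ⟶ ModuleCat.of R (Fin n → R) :=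
    ModuleCat.ofHom (LinearMap.single R (fun _ ↦ R) j)
  let p (j : Fin n) : ModuleCat.of R (Fin n → R) ⟶ ModuleCat.of R R :=
    ModuleCat.ofHom (LinearMap.proj j)
  have hsum : ∑ j, (LinearMap.single R (fun _ ↦ R) j) ∘ₗ
      (LinearMap.proj j : (Fin n → R) →ₗ[R] R) = LinearMap.id := by
    ext i k
    simp [Finset.sum_apply, Pi.single_apply]
  have hid : 𝟙 (ModuleCat.of R (Fin n → R)) = ∑ j, p j ≫ s j := by
    ext1
    rw [ModuleCat.hom_sum]
    exact hsum.symm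
  constructor
  · rw [injective_iff_map_eq_zero]
    intro z hz
    have hz' (j : Fin n) : (LinearMap.proj j : (Fin n → R) →ₗ[R] R).rTensor X z = 0 := by
      apply h.1
      have := hτ (p j) z
      rw [hz, map_zero] at this
      rw [map_zero]
      exact this.symm
    rw [← LinearMap.id_apply (R := R) z, ← LinearMap.rTensor_id, ← hsum]
    rw [show LinearMap.rTensor X (∑ j, (LinearMap.single R (fun _ ↦ R) j) ∘ₗ
      (LinearMap.proj j : (Fin n → R) →ₗ[R] R)) = ∑ j, LinearMap.rTensor X
        ((LinearMap.single R (fun _ ↦ R) j) ∘ₗ (LinearMap.proj j : (Fin n → R) →ₗ[R] R)) from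
      map_sum (LinearMap.rTensorHom X) _ _, LinearMap.sum_apply]
    refine Finset.sum_eq_zero fun j _ ↦ ?_
    rw [LinearMap.rTensor_comp_apply, hz' j, map_zero]
  · intro y
    choose z hz using fun j ↦ h.2 (G.map (p j) y)
    refine ⟨∑ j, (s j).hom.rTensor X (z j), ?_⟩
    have : y = ∑ j, G.map (s j) (G.map (p j) y) := by
      conv_lhs => rw [← ModuleCat.id_apply _ y, ← G.map_id, hid, G.map_sum]
      exact congr($(ModuleCat.hom_sum (fun j ↦ G.map (p j ≫ s j)) Finset.univ) y).trans
        (by simp [LinearMap.sum_apply])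
    rw [map_sum, this]
    refine Finset.sum_congr rfl fun j _ ↦ ?_
    rw [← hτ, hz]

include τ in
/-- A natural transformation from `- ⊗ X` to an additive functor right exact on finitely generated
modules is bijective on finitely generated modules as soon as it is bijective at `R`. -/
theorem bijective_of_bijective_self [IsNoetherianRing R] [G.Additive]
    (hG : IsRightExactOnFinite G)
    (hτ : ∀ ⦃A B : ModuleCat.{u} R⦄ (f : A ⟶ B) (z : A ⊗[R] X),
      G.map f (τ A z) = τ B (f.hom.rTensor X z))
    (h : Function.Bijective (τ (ModuleCat.of R R))) (A : ModuleCat.{u} R) [Module.Finite R A] :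
    Function.Bijective (τ A) := by
  have hsurj (A : ModuleCat.{u} R) [Module.Finite R A] : Function.Surjective (τ A) := by
    obtain ⟨n, q, hq⟩ := Module.Finite.exists_fin' R A
    let g : ModuleCat.of R (Fin n → R) ⟶ A := ModuleCat.ofHom q
    obtain ⟨-, hs⟩ := hG (ModuleCat.ofHom (LinearMap.ker q).subtype) g
      inferInstance inferInstance inferInstance
      (LinearMap.exact_subtype_ker_map q) hq
    intro y
    obtain ⟨x, rfl⟩ := hs y
    obtain ⟨z, rfl⟩ := (bijective_pi_of_bijective_self τ hτ h n).2 x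
    exact ⟨_, (hτ g z).symm⟩
  obtain ⟨n, q, hq⟩ := Module.Finite.exists_fin' R A
  let k : ModuleCat.of R (LinearMap.ker q) ⟶ ModuleCat.of R (Fin n → R) :=
    ModuleCat.ofHom (LinearMap.ker q).subtype
  let g : ModuleCat.of R (Fin n → R) ⟶ A := ModuleCat.ofHom q
  have hex : Function.Exact (LinearMap.ker q).subtype q := LinearMap.exact_subtype_ker_map q
  obtain ⟨he, hs⟩ := hG k g inferInstance inferInstance inferInstance hex hq
  exact LinearMap.bijective_of_surjective_of_bijective_of_right_exact
    (k.hom.rTensor X) (g.hom.rTensor X) (G.map k).hom (G.map g).hom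
    (τ _) (τ _) (τ _) (LinearMap.ext fun z ↦ hτ k z) (LinearMap.ext fun z ↦ hτ g z)
    (rTensor_exact X hex hq) he (hsurj _) (bijective_pi_of_bijective_self τ hτ h n)
    (LinearMap.rTensor_surjective X hq) hs

end comparison

namespace localCohomology
variable {R : Type u} [CommRing R] (J : Ideal R) (i : ℕ)

instance : (localCohomology J i).Additive where
  map_add := ModuleCat.hom_ext (LinearMap.ext fun x ↦ map_add_apply J i _ _ x)

/-- Local cohomology in the top degree is right exact on finitely generated modules. -/
lemma isRightExactOnFinite [IsNoetherianRing R]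
    (h : ∀ M : ModuleCat.{u} R, Module.Finite R M →
      Subsingleton ((localCohomology J (i + 1)).obj M)) :
    IsRightExactOnFinite (localCohomology J i) := by
  have hsurj ⦃A B : ModuleCat.{u} R⦄ (g : A ⟶ B) (hA : Module.Finite R A)
      (hg : Function.Surjective g) : Function.Surjective ((localCohomology J i).map g) := by
    have : Subsingleton ((localCohomology J (i + 1)).obj g.hom.shortComplexKer.X₁) :=
      h _ (inferInstanceAs (Module.Finite R (LinearMap.ker g.hom)))
    exact map_surjective_of_shortExact J i (LinearMap.shortExact_shortComplexKer hg)
  intro A B D f g hA hB hD hfg hg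
  refine ⟨fun x ↦ ⟨fun hx ↦ ?_, ?_⟩, hsurj g hB hg⟩
  · obtain ⟨y, rfl⟩ :=
      (exact_of_shortExact J i (LinearMap.shortExact_shortComplexKer (f := g.hom) hg) x).1 hx
    let q : A ⟶ ModuleCat.of R (LinearMap.ker g.hom) :=
      ModuleCat.ofHom (f.hom.codRestrict _ fun a ↦ (hfg _).2 ⟨a, rfl⟩)
    have hq : Function.Surjective q := by
      rintro ⟨b, hb⟩
      obtain ⟨a, rfl⟩ := (hfg b).1 hb
      exact ⟨a, rfl⟩
    obtain ⟨z, rfl⟩ := hsurj q hA hq y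
    refine ⟨z, ?_⟩
    rw [← ConcreteCategory.comp_apply, ← Functor.map_comp]
    rfl
  · rintro ⟨y, rfl⟩
    have h0 : f ≫ g = 0 := ModuleCat.hom_ext (LinearMap.ext fun a ↦ (hfg _).2 ⟨a, rfl⟩)
    rw [← ConcreteCategory.comp_apply, ← Functor.map_comp, h0, Functor.map_zero]
    rfl

variable (M : Type u) [AddCommGroup M] [Module R M]

/-- The natural map `A ⊗ H_J^i(M) → H_J^i(A ⊗ M)`. -/
def tensorComparison (A : Type u) [AddCommGroup A] [Module R A] :
    A ⊗[R] (localCohomology J i).obj (ModuleCat.of R M) →ₗ[R]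
      (localCohomology J i).obj (ModuleCat.of R (A ⊗[R] M)) :=
  TensorProduct.lift (LinearMap.mk₂ R
    (fun a z ↦ (localCohomology J i).map (ModuleCat.ofHom (TensorProduct.mk R A M a)) z)
    (fun a b z ↦ by rw [map_add, ModuleCat.ofHom_add, map_add_apply])
    (fun r a z ↦ by
      rw [← map_smul_apply]
      congr 3)
    (fun a x y ↦ map_add _ x y) (fun r a x ↦ map_smul ((localCohomology J i).map _).hom r x))

lemma tensorComparison_tmul {A : Type u} [AddCommGroup A] [Module R A] (a : A)
    (z : (localCohomology J i).obj (ModuleCat.of R M)) :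
    tensorComparison J i M A (a ⊗ₜ z) =
      (localCohomology J i).map (ModuleCat.ofHom (TensorProduct.mk R A M a)) z := rfl

lemma map_tensorComparison {A B : Type u} [AddCommGroup A] [Module R A] [AddCommGroup B]
    [Module R B] (f : A →ₗ[R] B) (z : A ⊗[R] (localCohomology J i).obj (ModuleCat.of R M)) :
    (localCohomology J i).map (ModuleCat.ofHom (f.rTensor M)) (tensorComparison J i M A z) =
      tensorComparison J i M B (f.rTensor _ z) := by
  induction z with
  | zero => simp only [map_zero]
  | add x y hx hy => simp only [map_add, hx, hy]
  | tmul a z =>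
    rw [LinearMap.rTensor_tmul, tensorComparison_tmul, tensorComparison_tmul,
      ← ConcreteCategory.comp_apply, ← Functor.map_comp]
    rfl

/-- The functor `A ↦ H_J^i(A ⊗ M)`. -/
def tensorFunctor : ModuleCat.{u} R ⥤ ModuleCat.{u} R where
  obj A := (localCohomology J i).obj (ModuleCat.of R (A ⊗[R] M))
  map f := (localCohomology J i).map (ModuleCat.ofHom (f.hom.rTensor M))
  map_id A := by
    rw [ModuleCat.hom_id, LinearMap.rTensor_id, ModuleCat.ofHom_id]
    exact (localCohomology J i).map_id _
  map_comp f g := by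
    rw [ModuleCat.hom_comp, LinearMap.rTensor_comp, ModuleCat.ofHom_comp, Functor.map_comp]

instance : (tensorFunctor J i M).Additive where
  map_add {A B f g} := by
    change (localCohomology J i).map (ModuleCat.ofHom ((f + g).hom.rTensor M)) = _
    rw [ModuleCat.hom_add, LinearMap.rTensor_add, ModuleCat.ofHom_add, Functor.map_add]
    rfl

/-- Top local cohomology commutes with tensoring by a finitely generated module. -/
theorem tensorComparison_bijective [IsNoetherianRing R] [Module.Finite R M]
    (h : ∀ M : ModuleCat.{u} R, Module.Finite R M →
      Subsingleton ((localCohomology J (i + 1)).obj M))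
    (A : Type u) [AddCommGroup A] [Module R A] [Module.Finite R A] :
    Function.Bijective (tensorComparison J i M A) := by
  refine bijective_of_bijective_self (G := tensorFunctor J i M)
    (fun A ↦ tensorComparison J i M A) ?_ ?_ ?_ (ModuleCat.of R A)
  · intro A B D f g hA hB hD hfg hg
    exact isRightExactOnFinite J i h (ModuleCat.ofHom (f.hom.rTensor M))
      (ModuleCat.ofHom (g.hom.rTensor M)) inferInstance inferInstance inferInstance
      (rTensor_exact M hfg hg) (LinearMap.rTensor_surjective M hg)
  · intro A B f z
    exact map_tensorComparison J i M f.hom z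
  · let e : ModuleCat.of R M ≅ ModuleCat.of R (R ⊗[R] M) := (TensorProduct.lid R M).symm.toModuleIso
    let e' := ((localCohomology J i).mapIso e).toLinearEquiv
    have : tensorComparison J i M R = ((TensorProduct.lid R _).trans e').toLinearMap := by
      ext z
      change _ = e' ((1 : R) • z)
      rw [one_smul]
      rfl
    change Function.Bijective (tensorComparison J i M R)
    rw [this]
    exact LinearEquiv.bijective _

end localCohomology

end

noncomputable section

open CategoryTheory TensorProduct
universe u

section homEvaluation
variable {R : Type u} [CommRing R] (C I : Type u) [AddCommGroup C] [Module R C]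
  [AddCommGroup I] [Module R I]

/-- The natural map `A ⊗ Hom(C, I) → Hom(Hom(A, C), I)`. -/
def homEvaluation (A : Type u) [AddCommGroup A] [Module R A] :
    A ⊗[R] (C →ₗ[R] I) →ₗ[R] ((A →ₗ[R] C) →ₗ[R] I) :=
  TensorProduct.lift (LinearMap.mk₂ R (fun a f ↦ f ∘ₗ LinearMap.applyₗ a)
    (fun a b f ↦ by ext; simp) (fun r a f ↦ by ext; simp)
    (fun a f g ↦ by ext; simp) (fun r a f ↦ by ext; simp))

lemma homEvaluation_tmul_apply {A : Type u} [AddCommGroup A] [Module R A] (a : A)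
    (f : C →ₗ[R] I) (φ : A →ₗ[R] C) : homEvaluation C I A (a ⊗ₜ f) φ = f (φ a) := rfl

lemma homEvaluation_rTensor {A B : Type u} [AddCommGroup A] [Module R A] [AddCommGroup B]
    [Module R B] (f : A →ₗ[R] B) (z : A ⊗[R] (C →ₗ[R] I)) (φ : B →ₗ[R] C) :
    homEvaluation C I B (f.rTensor _ z) φ = homEvaluation C I A z (φ ∘ₗ f) := by
  induction z with
  | zero => simp
  | add x y hx hy => simp only [map_add, LinearMap.add_apply, hx, hy]
  | tmul a z => simp [homEvaluation_tmul_apply]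

/-- The functor `A ↦ Hom(Hom(A, C), I)`. -/
def homHomFunctor : ModuleCat.{u} R ⥤ ModuleCat.{u} R where
  obj A := ModuleCat.of R ((A →ₗ[R] C) →ₗ[R] I)
  map f := ModuleCat.ofHom (LinearMap.lcomp R I (LinearMap.lcomp R C f.hom))

instance : (homHomFunctor (R := R) C I).Additive where
  map_add {A B f g} := by
    refine ModuleCat.hom_ext (LinearMap.ext fun (h : (A →ₗ[R] C) →ₗ[R] I) ↦
      LinearMap.ext fun φ ↦ ?_)
    change h (φ ∘ₗ (f + g).hom) = h (φ ∘ₗ f.hom) + h (φ ∘ₗ g.hom)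
    rw [ModuleCat.hom_add, LinearMap.comp_add, map_add]

lemma homHomFunctor_isRightExactOnFinite [Module.Injective R I] :
    IsRightExactOnFinite (homHomFunctor (R := R) C I) := by
  intro A B D f g _ _ _ hfg hg
  refine ⟨fun h ↦ ⟨fun hh ↦ ?_, ?_⟩, fun h ↦ ?_⟩
  · obtain ⟨h', hh'⟩ := Module.Injective.exists_comp_eq (LinearMap.lcomp R C f.hom) h (by
      intro φ hφ
      obtain ⟨ψ, rfl⟩ := (LinearMap.exact_lcomp_of_exact_of_surjective C hfg hg φ).1 hφ
      exact LinearMap.congr_fun (f := h ∘ₗ LinearMap.lcomp R C g.hom) hh ψ)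
    exact ⟨h', hh'⟩
  · rintro ⟨(h' : (A →ₗ[R] C) →ₗ[R] I), rfl⟩
    refine LinearMap.ext fun (φ : D →ₗ[R] C) ↦ ?_
    have h0 : (φ ∘ₗ g.hom) ∘ₗ f.hom = 0 := by
      rw [LinearMap.comp_assoc, hfg.linearMap_comp_eq_zero, LinearMap.comp_zero]
    exact (congrArg h' h0).trans (map_zero h')
  · obtain ⟨h', hh'⟩ := Module.Injective.exists_comp_eq (LinearMap.lcomp R C g.hom) h (by
      intro φ hφ
      rw [show φ = 0 from LinearMap.ext fun d ↦ by
        obtain ⟨b, rfl⟩ := hg d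
        exact congr($hφ b)]
      exact zero_mem _)
    exact ⟨h', hh'⟩

/-- For finitely generated `A` and injective `I`, the map `A ⊗ Hom(C, I) → Hom(Hom(A, C), I)` is
bijective. -/
theorem homEvaluation_bijective [IsNoetherianRing R] [Module.Injective R I]
    (A : Type u) [AddCommGroup A] [Module R A] [Module.Finite R A] :
    Function.Bijective (homEvaluation (R := R) C I A) := by
  refine bijective_of_bijective_self (G := homHomFunctor C I) (fun A ↦ homEvaluation C I A)
    (homHomFunctor_isRightExactOnFinite C I) ?_ ?_ (ModuleCat.of R A)
  · intro A B f z
    exact LinearMap.ext fun φ ↦ (homEvaluation_rTensor C I f.hom z φ).symm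
  · have : homEvaluation C I R = ((TensorProduct.lid R _).trans
        ((LinearMap.ringLmapEquivSelf R R C).congrLeft I R).symm).toLinearMap := by
      ext f φ
      simp [homEvaluation_tmul_apply]
    change Function.Bijective (homEvaluation C I R)
    rw [this]
    exact LinearEquiv.bijective _

/-- If `R → Hom(C, C)` is an isomorphism, the evaluation `C ⊗ Hom(C, I) → I` is bijective for
injective `I`. -/
theorem bijective_lift_flip_of_injective [IsNoetherianRing R] [Module.Injective R I]
    [Module.Finite R C] (hC : Function.Bijective (LinearMap.lsmul R C)) :
    Function.Bijective (TensorProduct.lift (LinearMap.id : (C →ₗ[R] I) →ₗ[R] (C →ₗ[R] I)).flip) := by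
  let e : R ≃ₗ[R] (C →ₗ[R] C) := LinearEquiv.ofBijective (LinearMap.lsmul R C) hC
  have : TensorProduct.lift (LinearMap.id : (C →ₗ[R] I) →ₗ[R] (C →ₗ[R] I)).flip =
      (((e.congrLeft I R).symm.trans (LinearMap.ringLmapEquivSelf R R I)).toLinearMap ∘ₗ
        homEvaluation C I C) := by
    ext c f
    simp [homEvaluation_tmul_apply, e]
  rw [this, LinearMap.coe_comp]
  exact (LinearEquiv.bijective _).comp (homEvaluation_bijective C I C)

end homEvaluation

section tensor
variable {R : Type u} [CommRing R] {C : Type u} [AddCommGroup C] [Module R C]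

/-- A finitely generated faithful module over a Noetherian ring detects vanishing by tensoring. -/
lemma subsingleton_of_subsingleton_tensor [IsNoetherianRing R] [Module.Finite R C]
    (hC : Function.Injective (LinearMap.lsmul R C)) (Q : Type u) [AddCommGroup Q] [Module R Q]
    [Subsingleton (C ⊗[R] Q)] : Subsingleton Q := by
  by_contra! hQ
  obtain ⟨a, ha⟩ := exists_ne (0 : Q)
  obtain ⟨c, hc⟩ := CharacterModule.exists_character_apply_ne_zero_of_ne_zero ha
  have : Nontrivial (CharacterModule Q) := ⟨c, 0, fun h ↦ hc (by rw [h]; rfl)⟩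
  have hsub : Subsingleton (C →ₗ[R] CharacterModule Q) := by
    refine (CharacterModule.homEquiv (R := R) (A := C) (B := Q)).toEquiv.subsingleton_congr.2 ?_
    exact ⟨fun f g ↦ CharacterModule.ext (A := C ⊗[R] Q) fun x ↦ by rw [Subsingleton.elim x 0, map_zero, map_zero]⟩
  obtain ⟨p, hp⟩ := associatedPrimes.nonempty R (CharacterModule Q)
  obtain ⟨hp', f, hf⟩ := (isAssociatedPrime_iff_exists_injective_linearMap _ _).1 hp
  have : Subsingleton (C →ₗ[R] R ⧸ p) := ⟨fun g h ↦ LinearMap.ext fun x ↦ hf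
    congr($(Subsingleton.elim (f ∘ₗ g) (f ∘ₗ h)) x)⟩
  obtain ⟨r, hr, hreg⟩ := IsSMulRegular.subsingleton_linearMap_iff.1 this
  obtain rfl : r = 0 := hC (LinearMap.ext fun x ↦ by simpa using Module.mem_annihilator.1 hr x)
  have := Ideal.Quotient.nontrivial_iff.2 hp'.ne_top
  exact one_ne_zero (hreg (by simp : (0 : R) • (1 : R ⧸ p) = (0 : R) • 0))

/-- If every map `Z → C` extends along `k : Z → P`, then `Z ⊗ Hom(C, I) → P ⊗ Hom(C, I)` is
injective for injective `I`. -/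
lemma rTensor_injective_of_lcomp_surjective [IsNoetherianRing R] (I : Type u) [AddCommGroup I]
    [Module R I] [Module.Injective R I] {Z P : Type u} [AddCommGroup Z] [Module R Z]
    [Module.Finite R Z] [AddCommGroup P] [Module R P] (k : Z →ₗ[R] P)
    (hk : Function.Surjective (LinearMap.lcomp R C k)) :
    Function.Injective (k.rTensor (C →ₗ[R] I)) := by
  rw [injective_iff_map_eq_zero]
  intro z hz
  apply (homEvaluation_bijective C I Z).1
  ext φ
  obtain ⟨ψ, rfl⟩ := hk φ
  rw [LinearMap.lcomp_apply', ← homEvaluation_rTensor, hz]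
  simp

/-- If `C ⊗ X` is injective, then `X → Hom(C, C ⊗ X)` is bijective, for `C` finitely generated with
`R ≅ Hom(C, C)` and `Ext¹(C, C) = 0`. -/
theorem bijective_mk_flip_of_injective_tensor [IsNoetherianRing R] [Module.Finite R C]
    (hC : Function.Bijective (LinearMap.lsmul R C))
    (hext : ∀ (n : ℕ) (q : (Fin n → R) →ₗ[R] C), Function.Surjective q →
      Function.Surjective (LinearMap.lcomp R C (LinearMap.ker q).subtype))
    (X : Type u) [AddCommGroup X] [Module R X] [Module.Injective R (C ⊗[R] X)] :
    Function.Bijective (TensorProduct.mk R C X).flip := by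
  set η := (TensorProduct.mk R C X).flip with hη
  have hCη : Function.Bijective (η.lTensor C) := by
    have hε := bijective_lift_flip_of_injective C (C ⊗[R] X) hC
    refine (Function.Bijective.of_comp_iff' hε _).1 ?_
    convert Function.bijective_id using 1
    rw [← LinearMap.coe_comp, ← LinearMap.id_coe (R := R)]
    congr 1
    ext c x
    simp [hη]
  have hs : Function.Surjective η := by
    have : Subsingleton (C ⊗[R] ((C →ₗ[R] C ⊗[R] X) ⧸ LinearMap.range η)) := by
      refine subsingleton_of_forall_eq 0 fun y ↦ ?_
      obtain ⟨x, rfl⟩ := LinearMap.lTensor_surjective C (LinearMap.range η).mkQ_surjective y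
      exact (lTensor_exact C (LinearMap.exact_map_mkQ_range η)
        (Submodule.mkQ_surjective _) x).2 (hCη.2 x)
    have := subsingleton_of_subsingleton_tensor hC.1 ((C →ₗ[R] C ⊗[R] X) ⧸ LinearMap.range η)
    exact LinearMap.range_eq_top.1 (Submodule.Quotient.subsingleton_iff.1 this)
  refine ⟨?_, hs⟩
  obtain ⟨n, q, hq⟩ := Module.Finite.exists_fin' R C
  let k := (LinearMap.ker q).subtype
  have hk := rTensor_injective_of_lcomp_surjective (C ⊗[R] X) k (hext n q hq)
  let ι := (LinearMap.ker η).subtype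
  have hιη : Function.Exact ι η := LinearMap.exact_subtype_ker_map η
  have hkq : Function.Exact k q := LinearMap.exact_subtype_ker_map q
  have comm {A B V W : Type u} [AddCommGroup A] [Module R A] [AddCommGroup B] [Module R B]
      [AddCommGroup V] [Module R V] [AddCommGroup W] [Module R W] (f : A →ₗ[R] B) (g : V →ₗ[R] W)
      (x : A ⊗[R] V) : f.rTensor W (g.lTensor A x) = g.lTensor B (f.rTensor V x) :=
    congr($((LinearMap.rTensor_comp_lTensor _ f g).trans (LinearMap.lTensor_comp_rTensor _ f g).symm) x)
  have : Subsingleton (C ⊗[R] LinearMap.ker η) := by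
    refine subsingleton_of_forall_eq 0 fun t ↦ ?_
    obtain ⟨t₀, rfl⟩ := LinearMap.rTensor_surjective _ hq t
    have h1 : q.rTensor X (ι.lTensor _ t₀) = 0 := by
      apply hCη.1
      rw [comm, ← LinearMap.lTensor_comp_apply, hιη.linearMap_comp_eq_zero]
      simp
    obtain ⟨z, hz⟩ := (rTensor_exact X hkq hq _).1 h1
    have h2 : η.lTensor _ z = 0 := by
      apply hk
      rw [comm, hz, ← LinearMap.lTensor_comp_apply, hιη.linearMap_comp_eq_zero]
      simp
    obtain ⟨w, rfl⟩ := (lTensor_exact _ hιη hs z).1 h2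
    rw [comm] at hz
    rw [← Module.Flat.lTensor_preserves_injective_linearMap (M := Fin n → R) ι
      (Submodule.injective_subtype _) hz, ← LinearMap.rTensor_comp_apply,
      hkq.linearMap_comp_eq_zero]
    simp
  have := subsingleton_of_subsingleton_tensor hC.1 (LinearMap.ker η)
  exact LinearMap.ker_eq_bot.1 (Submodule.subsingleton_iff_eq_bot.1 this)

end tensor

lemma Module.Injective.of_linearEquiv {R : Type u} [CommRing R] {E E' : Type u} [AddCommGroup E]
    [Module R E] [AddCommGroup E'] [Module R E'] (e : E ≃ₗ[R] E') (h : Module.Injective R E) :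
    Module.Injective R E' := by
  rw [Module.injective_iff_injective_object] at h ⊢
  exact Injective.of_iso e.toModuleIso h

/-- If `Ext¹(Y, Z)` vanishes, then maps to `Z` extend along the kernel of a surjection to `Y`. -/
lemma lcomp_surjective_of_subsingleton_ext {R : Type u} [CommRing R] {Y Z : ModuleCat.{u} R}
    [Subsingleton (Abelian.Ext.{u} Y Z 1)] {P : Type u} [AddCommGroup P] [Module R P]
    (q : P →ₗ[R] Y) (hq : Function.Surjective q) :
    Function.Surjective (LinearMap.lcomp R Z (LinearMap.ker q).subtype) := by
  intro φ
  obtain ⟨x, hx⟩ := Abelian.Ext.contravariant_sequence_exact₁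
    (LinearMap.shortExact_shortComplexKer hq) Z (Abelian.Ext.mk₀ (ModuleCat.ofHom φ)) rfl
    (Subsingleton.elim _ _)
  obtain ⟨f, rfl⟩ := (Abelian.Ext.mk₀_bijective _ _).2 x
  rw [Abelian.Ext.mk₀_comp_mk₀] at hx
  exact ⟨f.hom, congr($((Abelian.Ext.mk₀_bijective _ _).1 hx).hom)⟩

end

noncomputable section

open CategoryTheory TensorProduct
universe u
variable {R : Type u} [CommRing R]

/-- Grothendieck vanishing above the dimension of the ring. -/
lemma localCohomology.subsingleton_of_ringKrullDim_lt [IsNoetherianRing R] (J : Ideal R) (i : ℕ)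
    (h : ringKrullDim R < i) (M : ModuleCat.{u} R) (_ : Module.Finite R M) :
    Subsingleton ((localCohomology J i).obj M) :=
  subsingleton_of_supportDim_lt J i M ((Module.supportDim_le_ringKrullDim R M).trans_lt h)

end

noncomputable section
open CategoryTheory TensorProduct

/-- For a Cohen-Macaulay local ring of dimension `d` and a semidualizing
module `C`: `H_m^d(C)` is `C`-injective iff `H_m^d(C ⊗_R C)` is injective. -/
theorem stmt_13 (R : Type u) [CommRing R] [IsNoetherianRing R] [IsLocalRing R]
    (hCM : IsCohenMacaulayLocalRing R) (d : ℕ)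
    (hdim : ringKrullDim R = (d : WithBot ℕ∞))
    (C : ModuleCat.{u} R) (hC : IsSemidualizing R C) :
    IsCInjective R C ((localCohomology (IsLocalRing.maximalIdeal R) d).obj C) ↔
      Module.Injective R
        ↥((localCohomology (IsLocalRing.maximalIdeal R) d).obj
          (ModuleCat.of R (↥C ⊗[R] ↥C))) := by
  obtain ⟨hfin, hlsmul, hExt⟩ := hC
  let X := (localCohomology (IsLocalRing.maximalIdeal R) d).obj C
  let e : C ⊗[R] X ≃ₗ[R] (localCohomology (IsLocalRing.maximalIdeal R) d).obj
      (ModuleCat.of R (C ⊗[R] C)) :=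
    LinearEquiv.ofBijective _ (localCohomology.tensorComparison_bijective
      (IsLocalRing.maximalIdeal R) d C (localCohomology.subsingleton_of_ringKrullDim_lt _ _
        (by rw [hdim]; exact_mod_cast d.lt_succ_self)) C)
  constructor
  · rintro ⟨I, hI, ⟨f⟩⟩
    exact hI.of_linearEquiv (((f.lTensor C).trans (LinearEquiv.ofBijective _
      (bijective_lift_flip_of_injective C I hlsmul))).symm.trans e)
  · intro h
    have hinj := h.of_linearEquiv e.symm
    have : Subsingleton (Abelian.Ext.{u} C C 1) :=
      ((projectiveResolution C).extEquiv R C 1).toEquiv.subsingleton_congr.1 (hExt 1 le_rfl)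
    exact ⟨ModuleCat.of R (C ⊗[R] X), hinj, ⟨LinearEquiv.ofBijective _
      (bijective_mk_flip_of_injective_tensor hlsmul
        (fun n q hq ↦ lcomp_surjective_of_subsingleton_ext q hq) X)⟩⟩

end
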